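/- arXiv:2412.08817 — 4 statements merged into one kernel-verified Lean document; each statement's English description precedes it below -/
import Mathlib

section
/- Let H₁ be an m₁×n matrix and H₂ an m₂×n matrix over F₂ = ZMod 2 with H₂ * H₁ᵀ = 0. Then for every vector y in the row space of H₂ (i.e., y = H₂ᵀ.mulVec u for some u ∈ (ZMod 2)^{m₂}), the support of y is a stopping set of the Tanner graph of H₁. -/
/-- `E` is a stopping set of the Tanner graph of `H` if no check node (row) `c`
is adjacent to exactly one variable node (column) in `E`. -/
def IsStoppingSet {m n : ℕ} (H : Matrix (Fin m) (Fin n) (ZMod 2)) (E : Set (Fin n)) : Prop :=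
  ∀ c : Fin m, ¬ ∃! v : Fin n, v ∈ E ∧ H c v = 1

/-- The support of a vector in the kernel of `H` is a stopping set of the Tanner graph of `H`. -/
theorem isStoppingSet_support_of_mulVec_eq_zero {m n : ℕ}
    {H : Matrix (Fin m) (Fin n) (ZMod 2)} {y : Fin n → ZMod 2} (hy : H.mulVec y = 0) :
    IsStoppingSet H {j | y j = 1} := by
  rintro c ⟨v, ⟨hv, hcv⟩, huniq⟩
  rw [Set.mem_ofPred_eq] at hv
  have eq_one : ∀ a b : ZMod 2, a * b ≠ 0 → b = 1 ∧ a = 1 := by decide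
  have hsum : ∑ j, H c j * y j = 0 := congrFun hy c
  rw [Finset.sum_eq_single v (fun j _ hj => by_contra fun hne => hj (huniq j (eq_one _ _ hne)))
    (by simp), hv, hcv] at hsum
  exact absurd hsum (by decide)

theorem support_of_stabilizer_is_stopping_set {m₁ m₂ n : ℕ}
    (H₁ : Matrix (Fin m₁) (Fin n) (ZMod 2)) (H₂ : Matrix (Fin m₂) (Fin n) (ZMod 2))
    (h : H₂ * Matrix.transpose H₁ = 0) (u : Fin m₂ → ZMod 2) :
    IsStoppingSet H₁ {j | (Matrix.transpose H₂).mulVec u j = 1} := by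
  apply isStoppingSet_support_of_mulVec_eq_zero
  have hT : H₁ * H₂.transpose = 0 := by simpa using congrArg Matrix.transpose h
  rw [Matrix.mulVec_mulVec, hT, Matrix.zero_mulVec]
end

section
/- Let H be an m×n matrix over F₂ = ZMod 2. Define a finite set E of variable nodes to be peelable inductively: the empty set is peelable, and E is peelable if there exist a check node c and a variable node v ∈ E such that v is the unique variable node of E adjacent to c and E \ {v} is peelable. Then a finite set E is peelable if and only if the only stopping set of the Tanner graph of H contained in E is the empty set. -/
/-- A finite set of variable nodes is peelable if it can be reduced to the empty set
by repeatedly removing a variable node `v ∈ E` that is the unique neighbor in `E`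
of some check node `c` (a dangling check). -/
inductive Peelable {m n : ℕ} (H : Matrix (Fin m) (Fin n) (ZMod 2)) : Finset (Fin n) → Prop
  | empty : Peelable H ∅
  | step (E : Finset (Fin n)) (c : Fin m) (v : Fin n)
      (hv : v ∈ E) (hcv : H c v = 1)
      (huniq : ∀ w ∈ E, H c w = 1 → w = v)
      (hrest : Peelable H (E.erase v)) : Peelable H E

theorem Peelable.eq_empty_of_isStoppingSet {m n : ℕ}
    {H : Matrix (Fin m) (Fin n) (ZMod 2)} {E : Finset (Fin n)} (hE : Peelable H E)
    {S : Set (Fin n)} (hS : IsStoppingSet H S) (hSE : S ⊆ ↑E) : S = ∅ := by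
  induction hE with
  | empty => simpa using hSE
  | step E c v hv hcv huniq _ ih =>
    refine ih fun w hw => ?_
    refine Finset.mem_coe.2 (Finset.mem_erase.2 ⟨?_, hSE hw⟩)
    rintro rfl
    exact hS c ⟨w, ⟨hw, hcv⟩, fun u hu => huniq u (hSE hu.1) hu.2⟩

theorem peelable_of_forall_isStoppingSet {m n : ℕ}
    {H : Matrix (Fin m) (Fin n) (ZMod 2)} {E : Finset (Fin n)}
    (h : ∀ S : Set (Fin n), IsStoppingSet H S → S ⊆ ↑E → S = ∅) : Peelable H E := by
  induction E using Finset.strongInduction with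
  | H E ih =>
    by_cases hE : IsStoppingSet H (E : Set (Fin n))
    · rw [Finset.coe_eq_empty.1 (h E hE subset_rfl)]
      exact Peelable.empty
    · simp only [IsStoppingSet, not_forall, not_not] at hE
      obtain ⟨c, v, ⟨hv, hcv⟩, huniq⟩ := hE
      refine Peelable.step E c v hv hcv (fun w hw hcw => huniq w ⟨hw, hcw⟩) ?_
      exact ih _ (Finset.erase_ssubset hv) fun S hS hSE =>
        h S hS (hSE.trans (Finset.coe_subset.2 (Finset.erase_subset v E)))

theorem peelable_iff_no_nonempty_stopping_subset {m n : ℕ}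
    (H : Matrix (Fin m) (Fin n) (ZMod 2)) (E : Finset (Fin n)) :
    Peelable H E ↔ ∀ S : Set (Fin n), IsStoppingSet H S → S ⊆ ↑E → S = ∅ := by
  exact ⟨fun hE _ hS hSE => hE.eq_empty_of_isStoppingSet hS hSE,
    peelable_of_forall_isStoppingSet⟩
end

section
/- Let H be an m×n matrix over F₂ = ZMod 2 and let E be a finite set of variable nodes. Define the peeling step relation on sets of variable nodes: E ⇝ E \ {v} whenever there is a check node c whose unique neighbor in E is v. If E' is obtained from E by a (possibly empty) sequence of peeling steps and no peeling step applies to E' (equivalently, E' is a stopping set), then E' equals the union of all stopping sets of the Tanner graph of H contained in E, i.e., the maximal stopping set contained in E. In particular the final residual set of the peeling decoder does not depend on the order of peeling steps. -/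
/-- One peeling step: `E ⇝ E.erase v` whenever some check node `c` has `v` as its
unique neighbor in `E` (a dangling check). -/
def PeelStep {m n : ℕ} (H : Matrix (Fin m) (Fin n) (ZMod 2))
    (E E' : Finset (Fin n)) : Prop :=
  ∃ (c : Fin m) (v : Fin n), v ∈ E ∧ H c v = 1 ∧ (∀ w ∈ E, H c w = 1 → w = v) ∧
    E' = E.erase v

theorem PeelStep.subset {m n : ℕ} {H : Matrix (Fin m) (Fin n) (ZMod 2)}
    {E E' : Finset (Fin n)} (h : PeelStep H E E') : E' ⊆ E := by
  obtain ⟨_, v, _, _, _, rfl⟩ := h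
  exact E.erase_subset v

/-- A peeling step never removes a variable node of a stopping set. -/
theorem IsStoppingSet.subset_of_peelStep {m n : ℕ} {H : Matrix (Fin m) (Fin n) (ZMod 2)}
    {S : Set (Fin n)} (hS : IsStoppingSet H S) {E E' : Finset (Fin n)}
    (hSE : S ⊆ ↑E) (h : PeelStep H E E') : S ⊆ ↑E' := by
  obtain ⟨c, v, _, hcv, huniq, rfl⟩ := h
  intro x hx
  refine Finset.mem_coe.2 (Finset.mem_erase.2 ⟨?_, hSE hx⟩)
  rintro rfl
  exact hS c ⟨x, ⟨hx, hcv⟩, fun w hw => huniq w (hSE hw.1) hw.2⟩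

theorem isStoppingSet_of_forall_not_peelStep {m n : ℕ}
    {H : Matrix (Fin m) (Fin n) (ZMod 2)} {E : Finset (Fin n)}
    (h : ∀ E' : Finset (Fin n), ¬ PeelStep H E E') : IsStoppingSet H (↑E : Set (Fin n)) := by
  rintro c ⟨v, ⟨hv, hcv⟩, huniq⟩
  exact h _ ⟨c, v, hv, hcv, fun w hw hcw => huniq w ⟨hw, hcw⟩, rfl⟩

theorem peeling_residual_is_maximal_stopping_set {m n : ℕ}
    (H : Matrix (Fin m) (Fin n) (ZMod 2)) (E E' : Finset (Fin n))
    (hsteps : Relation.ReflTransGen (PeelStep H) E E')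
    (hstuck : ∀ E'' : Finset (Fin n), ¬ PeelStep H E' E'') :
    (↑E' : Set (Fin n)) = ⋃₀ {S : Set (Fin n) | IsStoppingSet H S ∧ S ⊆ ↑E} := by
  have hsub : E' ⊆ E := by
    clear hstuck
    induction hsteps with
    | refl => exact Finset.Subset.refl _
    | tail _ hstep ih => exact hstep.subset.trans ih
  refine Set.Subset.antisymm
    (Set.subset_sUnion_of_mem
      ⟨isStoppingSet_of_forall_not_peelStep hstuck, Finset.coe_subset.2 hsub⟩)
    (Set.sUnion_subset ?_)
  rintro S ⟨hS, hSE⟩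
  clear hstuck hsub
  induction hsteps with
  | refl => exact hSE
  | tail _ hstep ih => exact hS.subset_of_peelStep ih hstep
end

section
/- Let H be an m×n matrix over F₂ = ZMod 2 and let E₁, E₂ be disjoint sets of variable nodes such that no check node is adjacent both to some variable in E₁ and to some variable in E₂. Let C₁ (resp. C₂) be the set of check nodes adjacent to some variable of E₁ (resp. E₂). Then for any x₁ supported on E₁, any x₂ supported on E₂, and any s ∈ (ZMod 2)^m: H.mulVec (x₁ + x₂) = s if and only if (H.mulVec x₁) c = s c for all c ∈ C₁, (H.mulVec x₂) c = s c for all c ∈ C₂, and s c = 0 for all c ∉ C₁ ∪ C₂. -/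
/-- A vector supported on `E` contributes nothing to the syndrome at a check that is not adjacent
to any variable of `E`. -/
theorem mulVec_apply_eq_zero_of_not_adjacent {ι κ : Type*} [Fintype κ]
    (H : Matrix ι κ (ZMod 2)) {E : Set κ} {x : κ → ZMod 2} (hx : ∀ j ∉ E, x j = 0) {c : ι}
    (hc : ¬ ∃ v ∈ E, H c v = 1) : H.mulVec x c = 0 := by
  refine Finset.sum_eq_zero fun j _ => ?_
  change H c j * x j = 0
  by_cases hj : j ∈ E
  · have h_ne : H c j ≠ 1 := fun h => hc ⟨j, hj, h⟩
    have h_zero : H c j = 0 := by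
      generalize H c j = a at h_ne
      revert a
      decide
    rw [h_zero, zero_mul]
  · rw [hx j hj, mul_zero]

theorem syndrome_decoding_decomposes_across_components {m n : ℕ}
    (H : Matrix (Fin m) (Fin n) (ZMod 2)) (E₁ E₂ : Set (Fin n))
    (hdisj : Disjoint E₁ E₂)
    (hsep : ∀ c : Fin m, ¬ ((∃ v ∈ E₁, H c v = 1) ∧ (∃ v ∈ E₂, H c v = 1)))
    (x₁ x₂ : Fin n → ZMod 2)
    (hx₁ : ∀ j ∉ E₁, x₁ j = 0) (hx₂ : ∀ j ∉ E₂, x₂ j = 0)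
    (s : Fin m → ZMod 2) :
    H.mulVec (x₁ + x₂) = s ↔
      (∀ c ∈ {c : Fin m | ∃ v ∈ E₁, H c v = 1}, H.mulVec x₁ c = s c) ∧
      (∀ c ∈ {c : Fin m | ∃ v ∈ E₂, H c v = 1}, H.mulVec x₂ c = s c) ∧
      (∀ c ∉ {c : Fin m | ∃ v ∈ E₁, H c v = 1} ∪ {c : Fin m | ∃ v ∈ E₂, H c v = 1},
        s c = 0) := by
  have h₁ (c : Fin m) := mulVec_apply_eq_zero_of_not_adjacent H hx₁ (c := c)
  have h₂ (c : Fin m) := mulVec_apply_eq_zero_of_not_adjacent H hx₂ (c := c)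
  simp only [Matrix.mulVec_add, funext_iff, Pi.add_apply, Set.mem_ofPred_eq, Set.mem_union, not_or]
  constructor
  · intro h
    refine ⟨fun c hc => ?_, fun c hc => ?_, fun c hc => ?_⟩
    · rw [← h c, h₂ c fun hc' => hsep c ⟨hc, hc'⟩, add_zero]
    · rw [← h c, h₁ c fun hc' => hsep c ⟨hc', hc⟩, zero_add]
    · rw [← h c, h₁ c hc.1, h₂ c hc.2, add_zero]
  · rintro ⟨hs₁, hs₂, hs₀⟩ c
    by_cases hc₁ : ∃ v ∈ E₁, H c v = 1
    · rw [h₂ c fun hc₂ => hsep c ⟨hc₁, hc₂⟩, add_zero, hs₁ c hc₁]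
    · rw [h₁ c hc₁, zero_add]
      by_cases hc₂ : ∃ v ∈ E₂, H c v = 1
      · exact hs₂ c hc₂
      · rw [h₂ c hc₂, hs₀ c ⟨hc₁, hc₂⟩]
end
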